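/- Let G be an abelian group, let φ be a height on G, and let x ∈ (0,∞]. Then φ = φ_x (pointwise equality) if and only if φ satisfies the x-triangle inequality. In particular, (φ_x)_x = φ_x. -/

import Mathlib

open scoped ENNReal

/-- A (logarithmic) height on a multiplicatively written abelian group `G`:
a nonnegative real-valued function with `φ 1 = 0` and `φ a⁻¹ = φ a`. -/
def IsHeight {G : Type*} [CommGroup G] (φ : G → ℝ) : Prop :=
  (∀ a : G, 0 ≤ φ a) ∧ φ 1 = 0 ∧ ∀ a : G, φ a⁻¹ = φ a

/-- The value `(∑ φ(α_n)^x)^(1/x)` (resp. `max φ(α_n)` when `x = ∞`) of a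
finite factorization, recorded as a list. -/
noncomputable def listVal {G : Type*} (φ : G → ℝ) (x : ℝ≥0∞) (l : List G) : ℝ :=
  if x = ⊤ then (l.map φ).foldr max 0
  else ((l.map fun g => φ g ^ x.toReal).sum) ^ (1 / x.toReal)

/-- The `x`-metric version `φ_x` of a height `φ`:
`φ_x(α) = inf { (∑ φ(α_n)^x)^(1/x) : α = α_1⋯α_N }` (max instead of sum-power if `x = ∞`). -/
noncomputable def metricHeight {G : Type*} [CommGroup G] (φ : G → ℝ) (x : ℝ≥0∞) (α : G) : ℝ :=
  sInf { r : ℝ | ∃ l : List G, l.prod = α ∧ r = listVal φ x l }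

/-- `φ` satisfies the `x`-triangle inequality (the strong triangle inequality when `x = ∞`). -/
def HasTriangleIneq {G : Type*} [CommGroup G] (φ : G → ℝ) (x : ℝ≥0∞) : Prop :=
  ∀ a b : G, φ (a * b) ≤
    if x = ⊤ then max (φ a) (φ b)
    else (φ a ^ x.toReal + φ b ^ x.toReal) ^ (1 / x.toReal)

noncomputable def opx (x : ℝ≥0∞) (p q : ℝ) : ℝ :=
  if x = ⊤ then max p q else (p ^ x.toReal + q ^ x.toReal) ^ (1 / x.toReal)

theorem opx_mono (x : ℝ≥0∞) {p q p' q' : ℝ} (hp : 0 ≤ p) (hq : 0 ≤ q)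
    (h1 : p ≤ p') (h2 : q ≤ q') : opx x p q ≤ opx x p' q' := by
  unfold opx
  split_ifs with h
  · exact max_le_max h1 h2
  · have := Real.rpow_le_rpow hp h1 (ENNReal.toReal_nonneg (a := x))
    have := Real.rpow_le_rpow hq h2 (ENNReal.toReal_nonneg (a := x))
    have := Real.rpow_nonneg hp x.toReal
    have := Real.rpow_nonneg hq x.toReal
    exact Real.rpow_le_rpow (by linarith) (by linarith) (by positivity)

theorem opx_cont (x : ℝ≥0∞) : Continuous fun p : ℝ × ℝ => opx x p.1 p.2 := by
  unfold opx
  split_ifs with h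
  · fun_prop
  · have h0 := ENNReal.toReal_nonneg (a := x)
    have h1 : 0 ≤ 1 / x.toReal := by positivity
    exact ((continuous_fst.rpow_const fun _ => Or.inr h0).add
      (continuous_snd.rpow_const fun _ => Or.inr h0)).rpow_const fun _ => Or.inr h1

section
variable {G : Type*} [CommGroup G] {φ : G → ℝ} {x : ℝ≥0∞}

theorem sum_nonneg' (h0 : ∀ a, 0 ≤ φ a) (t : ℝ) (l : List G) :
    0 ≤ (l.map fun g => φ g ^ t).sum := by
  apply List.sum_nonneg
  intro y hy
  obtain ⟨g, -, rfl⟩ := List.mem_map.1 hy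
  exact Real.rpow_nonneg (h0 g) _

theorem fold_nonneg' (l : List ℝ) : 0 ≤ l.foldr max 0 := by
  induction l with
  | nil => simp
  | cons a l ih => simp [ih]

theorem listVal_nonneg (h0 : ∀ a, 0 ≤ φ a) (l : List G) : 0 ≤ listVal φ x l := by
  unfold listVal
  split_ifs with h
  · exact fold_nonneg' _
  · exact Real.rpow_nonneg (sum_nonneg' h0 _ l) _

theorem toReal_ne (hx : 0 < x) (h : x ≠ ⊤) : x.toReal ≠ 0 :=
  (ENNReal.toReal_pos hx.ne' h).ne'

theorem listVal_nil (hx : 0 < x) : listVal φ x [] = 0 := by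
  unfold listVal
  split_ifs with h
  · simp
  · have := toReal_ne hx h
    simp [this]

theorem listVal_singleton (hx : 0 < x) (h0 : ∀ a, 0 ≤ φ a) (a : G) : listVal φ x [a] = φ a := by
  unfold listVal
  split_ifs with h
  · simp [h0]
  · have := toReal_ne hx h
    simp [Real.rpow_rpow_inv (h0 a) this]

theorem listVal_append (hx : 0 < x) (h0 : ∀ a, 0 ≤ φ a) (l m : List G) :
    listVal φ x (l ++ m) = opx x (listVal φ x l) (listVal φ x m) := by
  unfold listVal opx
  split_ifs with h
  · induction l with
    | nil => simp [fold_nonneg']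
    | cons a l ih =>
      simp only [List.map_cons, List.cons_append, List.foldr_cons, ih, max_assoc]
  · have := toReal_ne hx h
    rw [one_div, Real.rpow_inv_rpow (sum_nonneg' h0 _ l) this,
      Real.rpow_inv_rpow (sum_nonneg' h0 _ m) this]
    simp

theorem set_ne (φ : G → ℝ) (x : ℝ≥0∞) (a : G) :
    { r : ℝ | ∃ l : List G, l.prod = a ∧ r = listVal φ x l }.Nonempty :=
  ⟨_, [a], by simp, rfl⟩

theorem set_bdd (h0 : ∀ a, 0 ≤ φ a) (a : G) :
    BddBelow { r : ℝ | ∃ l : List G, l.prod = a ∧ r = listVal φ x l } := by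
  refine ⟨0, ?_⟩
  rintro _ ⟨l, -, rfl⟩
  exact listVal_nonneg h0 l

theorem mh_le (h0 : ∀ a, 0 ≤ φ a) (l : List G) : metricHeight φ x l.prod ≤ listVal φ x l :=
  csInf_le (set_bdd h0 _) ⟨l, rfl, rfl⟩

theorem mh_nonneg (h0 : ∀ a, 0 ≤ φ a) (a : G) : 0 ≤ metricHeight φ x a := by
  apply le_csInf (set_ne φ x a)
  rintro _ ⟨l, -, rfl⟩
  exact listVal_nonneg h0 l

theorem mh_one (hx : 0 < x) (h0 : ∀ a, 0 ≤ φ a) : metricHeight φ x 1 = 0 := by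
  apply le_antisymm _ (mh_nonneg h0 _)
  have := mh_le (x := x) h0 []
  rwa [listVal_nil hx, List.prod_nil] at this

theorem mh_tri (hx : 0 < x) (h0 : ∀ a, 0 ≤ φ a) : HasTriangleIneq (metricHeight φ x) x := by
  intro a b
  change _ ≤ opx x _ _
  obtain ⟨u, -, hu, hu'⟩ := exists_seq_tendsto_sInf (set_ne φ x a) (set_bdd h0 a)
  obtain ⟨v, -, hv, hv'⟩ := exists_seq_tendsto_sInf (set_ne φ x b) (set_bdd h0 b)
  have := ((opx_cont x).tendsto (metricHeight φ x a, metricHeight φ x b)).comp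
    (hu.prodMk_nhds hv)
  refine ge_of_tendsto' this fun n => ?_
  obtain ⟨l, hl, hl'⟩ := hu' n
  obtain ⟨m, hm, hm'⟩ := hv' n
  have h := mh_le (x := x) h0 (l ++ m)
  rw [listVal_append hx h0, List.prod_append, hl, hm, ← hl', ← hm'] at h
  exact h

theorem le_listVal (hx : 0 < x) (h0 : ∀ a, 0 ≤ φ a) (h1 : φ 1 = 0)
    (ht : HasTriangleIneq φ x) (l : List G) : φ l.prod ≤ listVal φ x l := by
  induction l with
  | nil => simp [h1, listVal_nil hx]
  | cons a l ih =>
    have h := listVal_append hx h0 [a] l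
    rw [List.singleton_append, listVal_singleton hx h0] at h
    rw [h, List.prod_cons]
    exact (ht a l.prod).trans (opx_mono x (h0 _) (h0 _) le_rfl ih)

theorem eq_mh (hx : 0 < x) (h0 : ∀ a, 0 ≤ φ a) (h1 : φ 1 = 0)
    (ht : HasTriangleIneq φ x) (a : G) : φ a = metricHeight φ x a := by
  apply le_antisymm
  · apply le_csInf (set_ne φ x a)
    rintro _ ⟨l, rfl, rfl⟩
    exact le_listVal hx h0 h1 ht l
  · have := mh_le (x := x) h0 [a]
    rwa [listVal_singleton hx h0, List.prod_singleton] at this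

end

/-- `φ = φ_x` pointwise iff `φ` satisfies the `x`-triangle inequality; in particular
`(φ_x)_x = φ_x`. -/
theorem stmt_7 {G : Type*} [CommGroup G] (φ : G → ℝ) (hφ : IsHeight φ)
    (x : ℝ≥0∞) (hx : 0 < x) :
    ((∀ a : G, φ a = metricHeight φ x a) ↔ HasTriangleIneq φ x) ∧
      ∀ a : G, metricHeight (metricHeight φ x) x a = metricHeight φ x a := by
  refine ⟨⟨fun h => ?_, eq_mh hx hφ.1 hφ.2.1⟩, fun a =>
    (eq_mh hx (mh_nonneg hφ.1) (mh_one hx hφ.1) (mh_tri hx hφ.1) a).symm⟩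
  have e : φ = metricHeight φ x := funext h
  rw [e]
  exact mh_tri hx hφ.1
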